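/- Let n and k be positive integers with n − 2k ≥ 1. If S = (a_1, a_2, …, a_{n−k}) is a sequence in Z_n of length n − k such that 0 ∉ Σ(S) (S has no nonempty zero-sum subsequence), then there exists a ∈ Z_n, a ≠ 0, which occurs at least n − 2k + 1 times in S. -/

import Mathlib

open Finset
open scoped Pointwise

/-- The set of sums of all subsequences of `S`, the empty one included. -/
def subsetSums {G : Type*} [AddCommGroup G] [DecidableEq G] (S : Multiset G) : Finset G :=
  (S.powerset.map Multiset.sum).toFinset

/-- `S` has no nonempty zero-sum subsequence. -/
def ZeroSumFree {G : Type*} [AddCommGroup G] (S : Multiset G) : Prop :=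
  ∀ T ≤ S, T.sum = 0 → T = 0

section AddCommGroup

variable {G : Type*} [AddCommGroup G]

lemma ZeroSumFree.mono {S T : Multiset G} (hS : ZeroSumFree S) (h : T ≤ S) : ZeroSumFree T :=
  fun U hU => hS U (hU.trans h)

lemma ZeroSumFree.zero_notMem {S : Multiset G} (hS : ZeroSumFree S) : (0 : G) ∉ S := fun h =>
  Multiset.singleton_ne_zero (0 : G) (hS {0} (by simpa using h) (by simp))

lemma ZeroSumFree.sum_ne_zero {A B : Finset G} (hA : ZeroSumFree A.val) (h : B ⊆ A)
    (hB : B.Nonempty) : ∑ x ∈ B, x ≠ 0 := fun h0 =>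
  hB.ne_empty <| Finset.val_eq_zero.1 <|
    hA B.val (Finset.val_le_iff.2 h) ((Finset.sum_val B).trans h0)

variable [DecidableEq G]

lemma mem_subsetSums {S : Multiset G} {x : G} : x ∈ subsetSums S ↔ ∃ T ≤ S, T.sum = x := by
  simp [subsetSums]

lemma zero_mem_subsetSums (S : Multiset G) : (0 : G) ∈ subsetSums S :=
  mem_subsetSums.2 ⟨0, Multiset.zero_le _, rfl⟩

lemma subsetSums_add_subset (S T : Multiset G) :
    subsetSums S + subsetSums T ⊆ subsetSums (S + T) := by
  intro x hx
  obtain ⟨a, ha, b, hb, rfl⟩ := Finset.mem_add.1 hx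
  obtain ⟨U, hU, rfl⟩ := mem_subsetSums.1 ha
  obtain ⟨V, hV, rfl⟩ := mem_subsetSums.1 hb
  exact mem_subsetSums.2 ⟨U + V, add_le_add hU hV, by simp⟩

/-- **Scherk's theorem**: if `0` has only the trivial representation in `A + B`, then
`#A + #B ≤ #(A + B) + 1`. -/
theorem card_add_card_le_of_unique_zero (A B : Finset G) (hA : 0 ∈ A) (hB : 0 ∈ B)
    (h : ∀ a ∈ A, ∀ b ∈ B, a + b = 0 → b = 0) : #A + #B ≤ #(A + B) + 1 := by
  induction hm : #B using Nat.strong_induction_on generalizing A B with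
  | _ m ih =>
  subst hm
  by_cases hB1 : ∃ b ∈ B, b ≠ 0
  · obtain ⟨b, hb, hb0⟩ := hB1
    obtain ⟨e, he, heb⟩ : ∃ e ∈ A, e + b ∉ A := by
      by_contra! hcl
      have himg : A.image (· + b) = A :=
        Finset.eq_of_subset_of_card_le (Finset.image_subset_iff.2 hcl)
          (Finset.card_image_of_injective _ (add_left_injective b)).ge
      obtain ⟨a, ha, hab⟩ := Finset.mem_image.1 (himg.symm ▸ hA)
      exact hb0 (h a ha b hb hab)
    have hlt : #(addDysonETransform e (A, B)).2 < #B := by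
      refine Finset.card_lt_card (Finset.ssubset_iff_subset_ne.2 ⟨Finset.inter_subset_left, ?_⟩)
      intro heq
      have hmem : b ∈ B ∩ (-e +ᵥ A) := by rw [show B ∩ (-e +ᵥ A) = B from heq]; exact hb
      rw [Finset.mem_inter, Finset.mem_neg_vadd_finset_iff] at hmem
      exact heb hmem.2
    have hrec := ih _ hlt (addDysonETransform e (A, B)).1 (addDysonETransform e (A, B)).2
      (by simp [hA]) (by simp [hB, Finset.mem_neg_vadd_finset_iff, he]) ?_ rfl
    · have hcard := addDysonETransform.card e (A, B)
      have hsub := Finset.card_le_card (addDysonETransform.subset e (A, B))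
      dsimp only at hcard hsub
      omega
    · intro x hx y hy hxy
      simp only [addDysonETransform_fst, addDysonETransform_snd, Finset.mem_union,
        Finset.mem_inter, Finset.mem_neg_vadd_finset_iff, vadd_eq_add] at hx hy
      rw [Finset.mem_vadd_finset] at hx
      rcases hx with hx | ⟨c, hc, rfl⟩
      · exact h x hx y hy.1 hxy
      · rw [vadd_eq_add] at hxy
        have hc0 : c = 0 := h (e + y) hy.2 c hc (by rw [← hxy]; abel)
        subst hc0
        exact h e he y hy.1 (by simpa using hxy)
  · push Not at hB1
    have hB0 : B = {0} := by
      ext x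
      simpa using ⟨hB1 x, fun hx => hx ▸ hB⟩
    simp [hB0]

lemma card_subsetSums_add_le {S T : Multiset G} (h : ZeroSumFree (S + T)) :
    #(subsetSums S) + #(subsetSums T) ≤ #(subsetSums (S + T)) + 1 := by
  refine (card_add_card_le_of_unique_zero _ _ (zero_mem_subsetSums S) (zero_mem_subsetSums T)
    ?_).trans (Nat.add_le_add_right (Finset.card_le_card (subsetSums_add_subset S T)) 1)
  intro a ha b hb hab
  obtain ⟨U, hU, rfl⟩ := mem_subsetSums.1 ha
  obtain ⟨V, hV, rfl⟩ := mem_subsetSums.1 hb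
  have := h (U + V) (add_le_add hU hV) (by simpa using hab)
  simp [(add_eq_zero.1 this).2]

lemma sum_mem_subsetSums {A B : Finset G} (h : B ⊆ A) : ∑ x ∈ B, x ∈ subsetSums A.val :=
  mem_subsetSums.2 ⟨B.val, Finset.val_le_iff.2 h, Finset.sum_val B⟩

lemma two_mul_card_le_card_subsetSums (hG : ∀ A : Finset G, ∀ c, (∀ a ∈ A, a + a = c) → #A ≤ 2)
    {A : Finset G} (hne : A.Nonempty) (hA : ZeroSumFree A.val) :
    2 * #A ≤ #(subsetSums A.val) := by
  have h0A : (0 : G) ∉ A := fun h => hA.zero_notMem h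
  set s := ∑ x ∈ A, x with hs
  have hs0 : s ≠ 0 := hA.sum_ne_zero subset_rfl hne
  have hsmem : s ∈ subsetSums A.val := sum_mem_subsetSums subset_rfl
  by_cases h1 : #A = 1
  · rw [h1, mul_one, ← Finset.card_pair hs0]
    refine Finset.card_le_card ?_
    simp [Finset.insert_subset_iff, hsmem, zero_mem_subsetSums]
  have h2 : 1 < #A := by have := hne.card_pos; omega
  have herase : ∀ a ∈ A, ∑ x ∈ A.erase a, x = s - a := fun a ha => by
    rw [eq_sub_iff_add_eq, Finset.sum_erase_add _ _ ha]
  have hsne : ∀ a ∈ A, s - a ≠ 0 := fun a ha => by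
    rw [← herase a ha]
    refine hA.sum_ne_zero (Finset.erase_subset _ _) (Finset.card_pos.1 ?_)
    rw [Finset.card_erase_of_mem ha]; omega
  set B := A.image (s - ·) with hB
  have hBcard : #B = #A := Finset.card_image_of_injective _ sub_right_injective
  have hinter : #(A ∩ B) ≤ 2 := by
    by_cases h3 : #A = 2
    · exact h3 ▸ Finset.card_le_card Finset.inter_subset_left
    refine hG _ s fun a ha => ?_
    obtain ⟨haA, haB⟩ := Finset.mem_inter.1 ha
    obtain ⟨b, hb, hba⟩ := Finset.mem_image.1 haB
    by_contra hne2
    have hab : a ≠ b := by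
      rintro rfl
      exact hne2 (by rw [← eq_sub_iff_add_eq, hba])
    have hbm : b ∈ A.erase a := Finset.mem_erase.2 ⟨hab.symm, hb⟩
    refine hA.sum_ne_zero (B := (A.erase a).erase b)
      ((Finset.erase_subset _ _).trans (Finset.erase_subset _ _)) (Finset.card_pos.1 ?_) ?_
    · rw [Finset.card_erase_of_mem hbm, Finset.card_erase_of_mem haA]; omega
    · have := Finset.sum_erase_add (A.erase a) (fun x => x) hbm
      rw [herase a haA] at this
      rw [eq_sub_of_add_eq this, ← hba]; abel
  have hdisj : Disjoint (A ∪ B) {0, s} := by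
    simp only [Finset.disjoint_insert_right, Finset.disjoint_singleton_right, Finset.mem_union,
      hB, Finset.mem_image, not_or, not_exists, not_and]
    refine ⟨⟨h0A, hsne⟩, fun h => hsne s h (sub_self s), fun a ha h => h0A ?_⟩
    rwa [← sub_eq_self.1 h]
  have hsub : A ∪ B ∪ {0, s} ⊆ subsetSums A.val := by
    refine Finset.union_subset (Finset.union_subset ?_ ?_) ?_
    · intro a ha
      simpa using sum_mem_subsetSums (Finset.singleton_subset_iff.2 ha)
    · refine Finset.image_subset_iff.2 fun a ha => ?_
      rw [← herase a ha]
      exact sum_mem_subsetSums (Finset.erase_subset _ _)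
    · simp [Finset.insert_subset_iff, hsmem, zero_mem_subsetSums]
  have hle := Finset.card_le_card hsub
  rw [Finset.card_union_of_disjoint hdisj, Finset.card_pair hs0.symm] at hle
  have := Finset.card_union_add_card_inter A B
  omega

/-- Peel off the set of distinct elements `h` times, where `h` bounds all multiplicities. -/
theorem two_mul_card_lt_card_subsetSums_add
    (hG : ∀ A : Finset G, ∀ c, (∀ a ∈ A, a + a = c) → #A ≤ 2) (h : ℕ) (S : Multiset G)
    (hS : ZeroSumFree S) (hcount : ∀ a, S.count a ≤ h) :
    2 * Multiset.card S + 1 ≤ #(subsetSums S) + h := by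
  induction h generalizing S with
  | zero =>
    have hS0 : S = 0 := Multiset.eq_zero_of_forall_notMem fun a =>
      Multiset.count_eq_zero.1 (Nat.le_zero.1 (hcount a))
    subst hS0
    simpa using Finset.card_pos.2 ⟨0, zero_mem_subsetSums (0 : Multiset G)⟩
  | succ h ih =>
    by_cases hS0 : S = 0
    · rw [hS0, Multiset.card_zero]
      omega
    have hsplit : S.toFinset.val + (S - S.dedup) = S := add_tsub_cancel_of_le S.dedup_le
    have hset := two_mul_card_le_card_subsetSums hG (A := S.toFinset)
      (Multiset.toFinset_nonempty.2 hS0) (hS.mono S.dedup_le)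
    have hrest := ih (S - S.dedup) (hS.mono (Multiset.sub_le_self _ _)) fun a => by
      have := hcount a
      rw [Multiset.count_sub, Multiset.count_dedup]
      split_ifs with ha
      · omega
      · simp [Multiset.count_eq_zero.2 ha]
    have hadd := card_subsetSums_add_le (S := S.toFinset.val) (T := S - S.dedup)
      (by rw [hsplit]; exact hS)
    have hcard := congrArg Multiset.card hsplit
    rw [Multiset.card_add, Finset.card_val] at hcard
    rw [hsplit] at hadd
    omega

end AddCommGroup

lemma ZMod.card_le_two_of_add_self_eq {n : ℕ} [NeZero n] (A : Finset (ZMod n)) (c : ZMod n)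
    (h : ∀ a ∈ A, a + a = c) : #A ≤ 2 := by
  obtain rfl | ⟨b, hb⟩ := A.eq_empty_or_nonempty
  · simp
  rw [← Finset.card_image_of_injective A (sub_left_injective (b := b))]
  refine (Finset.card_le_card fun x hx => ?_).trans
    (IsAddCyclic.card_nsmul_eq_zero_le (α := ZMod n) (n := 2) two_pos)
  obtain ⟨a, ha, rfl⟩ := Finset.mem_image.1 hx
  rw [Finset.mem_filter]
  refine ⟨Finset.mem_univ _, ?_⟩
  rw [nsmul_sub, two_nsmul, two_nsmul, h a ha, h b hb, sub_self]

/-- Theorem 2.1: let `n, k` be positive integers with `n - 2k ≥ 1`. If `S` is a sequence in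
`ZMod n` of length `n - k` with no nonempty zero-sum subsequence, then some nonzero element
of `ZMod n` occurs at least `n - 2k + 1` times in `S`. -/
theorem stmt_7 (n k : ℕ) (hn : 0 < n) (hk : 0 < k) (hnk : 1 ≤ n - 2 * k)
    (S : Multiset (ZMod n)) (hcard : Multiset.card S = n - k)
    (hzs : ¬ ∃ T ≤ S, T ≠ 0 ∧ T.sum = 0) :
    ∃ a : ZMod n, a ≠ 0 ∧ n - 2 * k + 1 ≤ S.count a := by
  have : NeZero n := ⟨hn.ne'⟩
  have hS : ZeroSumFree S := fun T hT h0 => by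
    by_contra hne
    exact hzs ⟨T, hT, hne, h0⟩
  by_contra! hlt
  have hbound := two_mul_card_lt_card_subsetSums_add ZMod.card_le_two_of_add_self_eq
    (n - 2 * k) S hS fun a => by
      by_cases ha : a = 0
      · simp [ha, Multiset.count_eq_zero.2 hS.zero_notMem]
      · exact Nat.lt_succ_iff.1 (hlt a ha)
  have huniv := Finset.card_le_univ (subsetSums S)
  rw [ZMod.card] at huniv
  omega
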